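/- Let O₁,…,O_k be locally compact subsets of ℝ^{N₁},…,ℝ^{N_k} respectively, let O = O₁×⋯×O_k, let vᵢ : Oᵢ → ℝ be upper semicontinuous for i = 1,…,k, and let φ ∈ C²(O). Define v(x) = v₁(x₁)+⋯+v_k(x_k) for x = (x₁,…,x_k) ∈ O. If x̄ = (x̄₁,…,x̄_k) ∈ O is a local maximum of v − φ relative to O, then for every ε > 0 there exist symmetric matrices Xᵢ ∈ S^{Nᵢ} such that (D_{xᵢ}φ(x̄), Xᵢ) ∈ J̄^{2,+}vᵢ(x̄ᵢ) for each i = 1,…,k, and the block-diagonal matrix diag(X₁,…,X_k) satisfies diag(X₁,…,X_k) ≤ A + εA² in the Loewner (positive semidefinite) order, where A = D²φ(x̄) ∈ S^N with N = N₁+⋯+N_k. -/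

import Mathlib

/-!
STATEMENT 0 (maximum principle for semicontinuous functions,
Crandall–Ishii–Lions Theorem 3.2): let `Oᵢ ⊆ ℝ^{Nᵢ}` be locally compact,
`vᵢ : Oᵢ → ℝ` upper semicontinuous, `φ ∈ C²` near `O = O₁×⋯×O_k`, and let
`xb ∈ O` be a local maximum of `v − φ` relative to `O`, where
`v(x) = v₁(x₁)+⋯+v_k(x_k)`.  Then for every `ε > 0` there exist symmetric matrices
`Xᵢ ∈ S^{Nᵢ}` with `(D_{xᵢ}φ(xb), Xᵢ) ∈ J̄^{2,+} vᵢ (xbᵢ)` and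
`diag(X₁,…,X_k) ≤ A + εA²` in the Loewner order, `A = D²φ(xb)`.
-/

open Set Filter Topology

noncomputable section

/-- Euclidean norm on ℝⁿ. -/
def enormV {n : ℕ} (h : Fin n → ℝ) : ℝ := Real.sqrt (∑ j, h j ^ 2)

/-- The second-order superjet `J^{2,+} w (x)` of `w` relative to `O ⊆ ℝⁿ`:
pairs `(p,X) ∈ ℝⁿ × Sⁿ` with
`w(x+h) − w(x) ≤ p·h + ½ Xh·h + o(‖h‖²)` as `O ∋ x+h → x`. -/
def superjet {n : ℕ} (O : Set (Fin n → ℝ)) (w : (Fin n → ℝ) → ℝ) (x : Fin n → ℝ) :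
    Set ((Fin n → ℝ) × Matrix (Fin n) (Fin n) ℝ) :=
  {pX | pX.2.IsSymm ∧ ∀ ε > 0, ∃ δ > 0, ∀ h : Fin n → ℝ,
    x + h ∈ O → enormV h < δ →
    w (x + h) - w x ≤ (∑ j, pX.1 j * h j)
      + (1 / 2) * ∑ j, ∑ l, pX.2 j l * h j * h l + ε * enormV h ^ 2}

/-- The closure `J̄^{2,+} w (x)`: limits of elements of superjets at points
`xₙ ∈ O` converging to `x`. -/
def superjetCl {n : ℕ} (O : Set (Fin n → ℝ)) (w : (Fin n → ℝ) → ℝ) (x : Fin n → ℝ) :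
    Set ((Fin n → ℝ) × Matrix (Fin n) (Fin n) ℝ) :=
  {pX | ∃ (xs : ℕ → Fin n → ℝ)
      (ps : ℕ → (Fin n → ℝ) × Matrix (Fin n) (Fin n) ℝ),
    (∀ m, xs m ∈ O ∧ ps m ∈ superjet O w (xs m)) ∧
    Tendsto xs atTop (nhds x) ∧ Tendsto ps atTop (nhds pX)}

/-- The block-diagonal matrix `diag(X₁,…,X_k)` over the index type `Σ i, Fin (N i)`. -/
def blockDiag {k : ℕ} {N : Fin k → ℕ} (X : ∀ i, Matrix (Fin (N i)) (Fin (N i)) ℝ) :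
    Matrix (Σ i, Fin (N i)) (Σ i, Fin (N i)) ℝ :=
  fun a c => if h : a.1 = c.1 then X a.1 a.2 (Fin.cast (congrArg N h.symm) c.2) else 0

/-- The standard basis vector of the product space `Π i, ℝ^{N i}` corresponding to the
coordinate `a = ⟨i, j⟩`. -/
def coordVec {k : ℕ} {N : Fin k → ℕ} (a : Σ i, Fin (N i)) : ∀ i, Fin (N i) → ℝ :=
  Pi.single a.1 (Pi.single a.2 1)

/-- The full Hessian `A = D²φ(x̄)` of `φ` at `x̄`, as a matrix over the total index
type `Σ i, Fin (N i)` (with `N = N₁ + ⋯ + N_k`). -/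
def hessMat {k : ℕ} {N : Fin k → ℕ} (φ : (∀ i, Fin (N i) → ℝ) → ℝ)
    (xb : ∀ i, Fin (N i) → ℝ) : Matrix (Σ i, Fin (N i)) (Σ i, Fin (N i)) ℝ :=
  Matrix.of fun a c => iteratedFDeriv ℝ 2 φ xb ![coordVec a, coordVec c]

section ConvexSelection

open MeasureTheory RealInnerProductSpace

variable {E : Type*} [NormedAddCommGroup E] [InnerProductSpace ℝ E]

/-- A selection of the subdifferential of `g`. -/
def IsSubgradientSelection (g : E → ℝ) (s : E → E) : Prop :=
  ∀ a b, g a + ⟪s a, b - a⟫ ≤ g b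

theorem LipschitzWith.exists_differentiableAt_of_preimage [FiniteDimensional ℝ E]
    {F : Type*} [NormedAddCommGroup F] [NormedSpace ℝ F] [FiniteDimensional ℝ F]
    {C K : NNReal} {T : E → F} {Φ : E → E} (hT : LipschitzWith C T) (hΦ : LipschitzWith K Φ)
    {δ : ℝ} (hδ : 0 < δ) :
    ∃ p, ‖p‖ < δ ∧ ∀ z, Φ z = p → DifferentiableAt ℝ T z := by
  let _ : MeasurableSpace E := borel E
  have : BorelSpace E := ⟨rfl⟩
  let μ : Measure E := Measure.hausdorffMeasure (Module.finrank ℝ E)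
  let D : Set E := {z | ¬ DifferentiableAt ℝ T z}
  have hD : μ D = 0 := hT.ae_differentiableAt
  have hΦD : μ (Φ '' D) = 0 := by
    have := hΦ.hausdorffMeasure_image_le (d := Module.finrank ℝ E) (by positivity) D
    change μ (Φ '' D) ≤ _ * μ D at this
    rw [hD, mul_zero] at this
    exact nonpos_iff_eq_zero.mp this
  have hne : ¬ Metric.ball (0 : E) δ ⊆ Φ '' D := fun h =>
    (Metric.measure_ball_pos μ (0 : E) hδ).ne' (measure_mono_null h hΦD)
  obtain ⟨p, hp, hpD⟩ := not_subset.mp hne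
  refine ⟨p, by simpa using hp, fun z hz => ?_⟩
  by_contra hd
  exact hpD ⟨z, hd, hz⟩

/-- A function on the line whose subgradients are approximately affine on `[0, 1]` is approximately
quadratic. -/
theorem abs_sub_sub_le_of_subgradient_affine {G S : ℝ → ℝ}
    (hG : ∀ τ σ, G τ + (σ - τ) * S τ ≤ G σ) {a b η : ℝ}
    (hS : ∀ τ, 0 ≤ τ → τ ≤ 1 → |S τ - a - τ * b| ≤ η) :
    |G 1 - G 0 - a - 1 / 2 * b| ≤ η := by
  have key : ∀ m : ℕ, 0 < m → |G 1 - G 0 - a - 1 / 2 * b| ≤ η + |b| / 2 * (m : ℝ)⁻¹ := by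
    intro m hm
    have hm' : (0 : ℝ) < m := by exact_mod_cast hm
    set r : ℝ := (m : ℝ)⁻¹
    have hr : 0 < r := by positivity
    have hrm : m * r = 1 := mul_inv_cancel₀ hm'.ne'
    have step : ∀ j : ℕ, j ≤ m →
        G (j * r) ≤ G 0 + j * r * (a + η) + j * (j + 1) / 2 * r ^ 2 * b ∧
        G 0 + j * r * (a - η) + j * (j - 1) / 2 * r ^ 2 * b ≤ G (j * r) := by
      intro j
      induction j with
      | zero => intro _; simp
      | succ j ih =>
        intro hj
        obtain ⟨hu, hl⟩ := ih (by omega)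
        have hj' : (j : ℝ) + 1 ≤ m := by exact_mod_cast hj
        have hj1 : ((j : ℝ) + 1) * r ≤ 1 :=
          (mul_le_mul_of_nonneg_right hj' hr.le).trans_eq hrm
        have h1 := hG ((j + 1) * r) (j * r)
        have h2 := hG (j * r) ((j + 1) * r)
        have h3 := (abs_le.mp (hS ((j + 1) * r) (by positivity) hj1)).2
        have h4 := (abs_le.mp (hS (j * r) (by positivity) (by linarith))).1
        have h5 := mul_le_mul_of_nonneg_left h3 hr.le
        have h6 := mul_le_mul_of_nonneg_left h4 hr.le
        push_cast
        constructor
        · nlinarith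
        · nlinarith
    obtain ⟨hu, hl⟩ := step m le_rfl
    rw [hrm] at hu hl
    have e1 : (m : ℝ) * (m + 1) / 2 * r ^ 2 * b = 1 / 2 * b + b / 2 * r := by
      calc _ = ((m * r) ^ 2 + (m * r) * r) / 2 * b := by ring
        _ = _ := by rw [hrm]; ring
    have e2 : (m : ℝ) * (m - 1) / 2 * r ^ 2 * b = 1 / 2 * b - b / 2 * r := by
      calc _ = ((m * r) ^ 2 - (m * r) * r) / 2 * b := by ring
        _ = _ := by rw [hrm]; ring
    rw [e1] at hu
    rw [e2] at hl
    have h1 : b / 2 * r ≤ |b| / 2 * r := by gcongr; exact le_abs_self b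
    rw [abs_le]
    constructor <;> linarith
  have hlim : Tendsto (fun m : ℕ => η + |b| / 2 * (m : ℝ)⁻¹) atTop (𝓝 (η + |b| / 2 * 0)) :=
    (tendsto_inv_atTop_nhds_zero_nat.const_mul _).const_add _
  rw [mul_zero, add_zero] at hlim
  exact ge_of_tendsto hlim (eventually_atTop.mpr ⟨1, fun m hm => key m hm⟩)

namespace IsSubgradientSelection

variable {g : E → ℝ} {s : E → E}

theorem monotone (h : IsSubgradientSelection g s) (a b : E) : 0 ≤ ⟪s b - s a, b - a⟫ := by
  have h1 := h a b
  have h2 := h b a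
  rw [← neg_sub b a, inner_neg_right] at h2
  rw [inner_sub_left]
  linarith

theorem norm_sub_le_norm_add_sub (h : IsSubgradientSelection g s) (a b : E) :
    ‖b - a‖ ≤ ‖(b + s b) - (a + s a)‖ := by
  have h1 := h.monotone a b
  refine (sq_le_sq₀ (norm_nonneg _) (norm_nonneg _)).mp ?_
  have : (b + s b) - (a + s a) = (b - a) + (s b - s a) := by abel
  rw [this, norm_add_sq_real, real_inner_comm]
  nlinarith [sq_nonneg ‖s b - s a‖]

/-- The inverse of `ξ ↦ ξ + s ξ` extends to a Lipschitz map. -/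
theorem exists_lipschitzWith_leftInverse [FiniteDimensional ℝ E]
    (h : IsSubgradientSelection g s) :
    ∃ (C : NNReal) (T : E → E), LipschitzWith C T ∧ ∀ ξ, T (ξ + s ξ) = ξ := by
  have hinj : Function.Injective fun ξ => ξ + s ξ := fun a b hab => by
    have := h.norm_sub_le_norm_add_sub a b
    have hab' : (b + s b) - (a + s a) = 0 := sub_eq_zero.mpr hab.symm
    rw [hab', norm_zero] at this
    exact (sub_eq_zero.mp (norm_le_zero_iff.mp this)).symm
  have hL := Function.leftInverse_invFun hinj
  have hlip : LipschitzOnWith 1 (Function.invFun fun ξ => ξ + s ξ) (range fun ξ => ξ + s ξ) := by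
    refine LipschitzOnWith.of_dist_le_mul ?_
    rintro _ ⟨a, rfl⟩ _ ⟨b, rfl⟩
    rw [hL a, hL b, dist_eq_norm, dist_eq_norm, NNReal.coe_one, one_mul]
    exact h.norm_sub_le_norm_add_sub b a
  obtain ⟨T, hT, heq⟩ := hlip.extend_finite_dimension
  exact ⟨_, T, hT, fun ξ => by rw [← heq (mem_range_self ξ)]; exact hL ξ⟩

theorem continuous [FiniteDimensional ℝ E] (h : IsSubgradientSelection g s) : Continuous g := by
  have hc : ConvexOn ℝ univ g := by
    refine ⟨convex_univ, fun x _ y _ a b ha hb hab => ?_⟩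
    have h1 := mul_le_mul_of_nonneg_left (h (a • x + b • y) x) ha
    have h2 := mul_le_mul_of_nonneg_left (h (a • x + b • y) y) hb
    have h3 : a * ⟪s (a • x + b • y), x - (a • x + b • y)⟫
        + b * ⟪s (a • x + b • y), y - (a • x + b • y)⟫ = 0 := by
      rw [← real_inner_smul_right, ← real_inner_smul_right, ← inner_add_right]
      have : a • (x - (a • x + b • y)) + b • (y - (a • x + b • y)) = 0 := by
        obtain rfl : b = 1 - a := by linarith
        module
      rw [this, inner_zero_right]
    simp only [smul_eq_mul]
    have h4 : (a + b) * g (a • x + b • y) = g (a • x + b • y) := by rw [hab, one_mul]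
    linarith
  exact continuousOn_univ.mp (hc.continuousOn isOpen_univ)

/-- Where `g` is touched from above by a paraboloid, `s` is Lipschitz. -/
theorem norm_sub_le_of_le_paraboloid (h : IsSubgradientSelection g s) {ξ : E} {C : ℝ}
    (hC : ∀ ζ, g ζ ≤ g ξ + ⟪s ξ, ζ - ξ⟫ + C * ‖ζ - ξ‖ ^ 2) (hC0 : 0 ≤ C) (ζ : E) :
    ‖s ζ - s ξ‖ ≤ 4 * C * ‖ζ - ξ‖ := by
  have key : ∀ u, ⟪s ζ - s ξ, u⟫ ≤ C * ‖ζ - ξ + u‖ ^ 2 := fun u => by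
    have h1 := h ζ (ζ + u)
    have h2 := h ξ ζ
    have h3 := hC (ζ + u)
    rw [add_sub_cancel_left] at h1
    rw [show ζ + u - ξ = ζ - ξ + u by abel, inner_add_right] at h3
    rw [inner_sub_left]
    linarith
  rcases eq_or_ne (s ζ - s ξ) 0 with h0 | h0
  · rw [h0, norm_zero]; positivity
  rcases eq_or_ne (ζ - ξ) 0 with h1 | h1
  · rw [sub_eq_zero.mp h1]; simp
  set d := s ζ - s ξ
  have hd : 0 < ‖d‖ := norm_pos_iff.mpr h0
  have ht : 0 < ‖ζ - ξ‖ := norm_pos_iff.mpr h1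
  have hk := key ((‖ζ - ξ‖ / ‖d‖) • d)
  have hn : ‖(‖ζ - ξ‖ / ‖d‖) • d‖ = ‖ζ - ξ‖ := by
    rw [norm_smul, Real.norm_of_nonneg (by positivity)]; field_simp
  have h2 : ‖ζ - ξ + (‖ζ - ξ‖ / ‖d‖) • d‖ ≤ 2 * ‖ζ - ξ‖ := by
    refine (norm_add_le _ _).trans ?_
    rw [hn]; linarith
  have h3 : ‖ζ - ξ + (‖ζ - ξ‖ / ‖d‖) • d‖ ^ 2 ≤ (2 * ‖ζ - ξ‖) ^ 2 := by gcongr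
  rw [inner_smul_right, real_inner_self_eq_norm_sq] at hk
  have h4 : ‖ζ - ξ‖ / ‖d‖ * ‖d‖ ^ 2 = ‖ζ - ξ‖ * ‖d‖ := by field_simp
  rw [h4] at hk
  have h5 : ‖ζ - ξ‖ * ‖d‖ ≤ ‖ζ - ξ‖ * (4 * C * ‖ζ - ξ‖) := by nlinarith
  exact le_of_mul_le_mul_left h5 ht

/-- Differentiability of the resolvent at `ξ + s ξ` gives differentiability of `s` at a point `ξ`
where `g` is touched from above by a paraboloid. -/
theorem differentiableAt_of_leftInverse [FiniteDimensional ℝ E]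
    {ξ : E} {C : ℝ} (hs : ∀ ζ, ‖s ζ - s ξ‖ ≤ C * ‖ζ - ξ‖) {T : E → E}
    (hT : ∀ ζ, T (ζ + s ζ) = ζ) (hd : DifferentiableAt ℝ T (ξ + s ξ)) :
    DifferentiableAt ℝ s ξ := by
  set G : E → E := fun ζ => ζ + s ζ
  have hG : ∀ ζ, ‖G ζ - G ξ‖ ≤ (1 + C) * ‖ζ - ξ‖ := fun ζ => by
    have : G ζ - G ξ = (ζ - ξ) + (s ζ - s ξ) := by simp only [G]; abel
    rw [this]
    refine (norm_add_le _ _).trans ?_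
    linarith [hs ζ]
  have hGO : (fun ζ => G ζ - G ξ) =O[𝓝 ξ] fun ζ => ζ - ξ :=
    Asymptotics.IsBigO.of_bound _ (Eventually.of_forall hG)
  have hGc : ContinuousAt G ξ := by
    have h1 : Tendsto (fun ζ => ζ - ξ) (𝓝 ξ) (𝓝 0) := by
      have : Continuous fun ζ : E => ζ - ξ := by fun_prop
      simpa using this.tendsto ξ
    exact tendsto_sub_nhds_zero_iff.mp (hGO.trans_tendsto h1)
  set P := fderiv ℝ T (G ξ)
  have hP : (fun ζ => (ζ - ξ) - P (G ζ - G ξ)) =o[𝓝 ξ] fun ζ => ζ - ξ := by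
    have h1 := (hd.hasFDerivAt.isLittleO.comp_tendsto hGc).trans_isBigO hGO
    refine h1.congr_left fun ζ => ?_
    simp only [Function.comp, G, hT]
    rfl
  have hsurj : Function.Surjective P := by
    refine LinearMap.range_eq_top (f := (P : E →ₗ[ℝ] E)).mp ?_
    rw [← Submodule.orthogonal_eq_bot_iff,
      Submodule.eq_bot_iff]
    intro w hw
    by_contra hw0
    have hwp : 0 < ‖w‖ := norm_pos_iff.mpr hw0
    have hb := hP.def (c := 1 / 2) (by norm_num)
    have ht : Tendsto (fun t : ℝ => ξ + t • w) (𝓝[>] 0) (𝓝 ξ) := by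
      have : Continuous fun t : ℝ => ξ + t • w := by fun_prop
      have := this.tendsto 0
      simp only [zero_smul, add_zero] at this
      exact this.mono_left nhdsWithin_le_nhds
    obtain ⟨t, htb, ht0⟩ := ((ht.eventually hb).and self_mem_nhdsWithin).exists
    have ht0 : 0 < t := ht0
    rw [add_sub_cancel_left] at htb
    have horth : ⟪P (G (ξ + t • w) - G ξ), w⟫ = 0 := hw _ ⟨_, rfl⟩
    have h1 : ⟪t • w - P (G (ξ + t • w) - G ξ), w⟫ = t * ‖w‖ ^ 2 := by
      rw [inner_sub_left, horth, inner_smul_left, real_inner_self_eq_norm_sq]; simp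
    have h2 := real_inner_le_norm (t • w - P (G (ξ + t • w) - G ξ)) w
    rw [h1] at h2
    rw [norm_smul, Real.norm_of_nonneg ht0.le] at htb
    have h3 := h2.trans (mul_le_mul_of_nonneg_right htb hwp.le)
    have h4 : 0 < t * ‖w‖ ^ 2 := by positivity
    nlinarith
  have hinj : Function.Injective P :=
    (LinearMap.injective_iff_surjective (f := (P : E →ₗ[ℝ] E))).mpr hsurj
  let Pe : E ≃L[ℝ] E := ContinuousLinearEquiv.ofBijective P
    (LinearMap.ker_eq_bot.mpr hinj) (LinearMap.range_eq_top.mpr hsurj)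
  have hTd : HasFDerivAt T (Pe : E →L[ℝ] E) (G ξ) := by
    have : (Pe : E →L[ℝ] E) = P := by ext x; rfl
    rw [this]; exact hd.hasFDerivAt
  have hGd := HasFDerivAt.of_local_left_inverse hGc hTd (Eventually.of_forall hT)
  have : s = fun ζ => G ζ - ζ := by ext ζ; simp [G]
  rw [this]
  exact hGd.differentiableAt.sub differentiableAt_id

/-- A combination of Jensen's lemma and Alexandrov's theorem. -/
theorem exists_differentiableAt_touching [FiniteDimensional ℝ E]
    (h : IsSubgradientSelection g s) {M : E →L[ℝ] E} (hM : ∀ x y, ⟪M x, y⟫ = ⟪x, M y⟫)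
    {c : ℝ} (hc : 0 < c) (hg0 : g 0 = 0)
    (hg : ∀ ξ, g ξ ≤ 1 / 2 * ⟪M ξ, ξ⟫ - c / 2 * ‖ξ‖ ^ 2) {δ : ℝ} (hδ : 0 < δ) :
    ∃ ξ, ‖ξ‖ ≤ δ ∧ ‖s ξ‖ ≤ δ ∧ DifferentiableAt ℝ s ξ ∧
      ∀ ζ, g ζ ≤ g ξ + ⟪s ξ, ζ - ξ⟫ + 1 / 2 * ⟪M (ζ - ξ), ζ - ξ⟫ := by
  obtain ⟨C, T, hTl, hT⟩ := h.exists_lipschitzWith_leftInverse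
  have hΦ : LipschitzWith (1 + C + ‖M‖₊ * C) fun z => (z - T z) - M (T z) :=
    (LipschitzWith.id.sub hTl).sub (M.lipschitz.comp hTl)
  set ρ := min (c * δ / 2) (δ / (2 * (1 + 2 * ‖M‖ / c)))
  have hρ : 0 < ρ := by simp only [ρ]; positivity
  obtain ⟨p, hp, hpd⟩ := hTl.exists_differentiableAt_of_preimage hΦ hρ
  let F : E → ℝ := fun ξ => g ξ - 1 / 2 * ⟪M ξ, ξ⟫ - ⟪p, ξ⟫
  have hFc : Continuous F := by
    have := h.continuous
    fun_prop
  have hF0 : F 0 = 0 := by simp [F, hg0]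
  have hFbd : ∀ ξ, 0 ≤ F ξ → ‖ξ‖ ≤ 2 * ‖p‖ / c := fun ξ hξ => by
    have h1 := hg ξ
    have h2 := neg_le_of_abs_le (abs_real_inner_le_norm p ξ)
    have h3 : c / 2 * ‖ξ‖ ^ 2 ≤ ‖p‖ * ‖ξ‖ := by simp only [F] at hξ; linarith
    rw [le_div_iff₀ hc]
    by_contra! h4
    have h5 : 0 < ‖ξ‖ := by
      by_contra! h6
      have : ‖ξ‖ = 0 := le_antisymm h6 (norm_nonneg _)
      rw [this] at h4
      linarith [norm_nonneg p]
    nlinarith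
  obtain ⟨ξ, -, hξ⟩ := (isCompact_closedBall (0 : E) (2 * ‖p‖ / c)).exists_isMaxOn
    ⟨0, Metric.mem_closedBall_self (by positivity)⟩ hFc.continuousOn
  have hξ0 : 0 ≤ F ξ := by
    rw [← hF0]; exact hξ (Metric.mem_closedBall_self (by positivity))
  have hmax : ∀ ζ, F ζ ≤ F ξ := fun ζ => by
    by_cases hζ : 0 ≤ F ζ
    · exact hξ (by simpa using hFbd ζ hζ)
    · linarith
  have hexp : ∀ ζ, g ζ ≤ g ξ + ⟪p + M ξ, ζ - ξ⟫ + 1 / 2 * ⟪M (ζ - ξ), ζ - ξ⟫ := fun ζ => by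
    have h1 := hmax ζ
    simp only [F] at h1
    have h2 := hM ξ ζ
    have h3 := real_inner_comm (M ζ) ξ
    simp only [map_sub, inner_sub_left, inner_sub_right, inner_add_left]
    linarith
  have hupper : ∀ u, ⟪M u, u⟫ ≤ ‖M‖ * ‖u‖ ^ 2 := fun u => by
    refine (real_inner_le_norm _ _).trans ?_
    rw [pow_two, ← mul_assoc]
    gcongr
    exact M.le_opNorm u
  have hsξ : s ξ = p + M ξ := by
    by_contra hne
    have hd : 0 < ‖s ξ - (p + M ξ)‖ := norm_pos_iff.mpr (sub_ne_zero.mpr hne)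
    set d := s ξ - (p + M ξ)
    set t := 1 / (‖M‖ + 1)
    have ht : 0 < t := by positivity
    have h1 := h ξ (ξ + t • d)
    have h2 := hexp (ξ + t • d)
    have h3 := hupper (t • d)
    simp only [add_sub_cancel_left] at h1 h2
    have h4 : ⟪d, t • d⟫ ≤ 1 / 2 * (‖M‖ * ‖t • d‖ ^ 2) := by
      have : ⟪d, t • d⟫ = ⟪s ξ, t • d⟫ - ⟪p + M ξ, t • d⟫ := by rw [← inner_sub_left]
      linarith
    rw [inner_smul_right, real_inner_self_eq_norm_sq, norm_smul, Real.norm_of_nonneg ht.le] at h4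
    have h5 : ‖M‖ * t ≤ 1 := by
      simp only [t]; rw [mul_one_div, div_le_one (by positivity)]; linarith
    have h6 : 0 < t * ‖d‖ ^ 2 := by positivity
    nlinarith
  have hdT : DifferentiableAt ℝ T (ξ + s ξ) := hpd _ (by rw [hT, hsξ]; abel)
  have hξle : ‖ξ‖ ≤ 2 * ‖p‖ / c := hFbd ξ hξ0
  rw [← hsξ] at hexp
  refine ⟨ξ, ?_, ?_, ?_, hexp⟩
  · refine hξle.trans ?_
    rw [div_le_iff₀ hc]
    have : ρ ≤ c * δ / 2 := min_le_left _ _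
    linarith
  · have h1 : ρ ≤ δ / (2 * (1 + 2 * ‖M‖ / c)) := min_le_right _ _
    have h2 : ‖p + M ξ‖ ≤ ‖p‖ * (1 + 2 * ‖M‖ / c) := by
      refine (norm_add_le _ _).trans ?_
      have := (M.le_opNorm ξ).trans (mul_le_mul_of_nonneg_left hξle (norm_nonneg M))
      have e : ‖p‖ * (1 + 2 * ‖M‖ / c) = ‖p‖ + ‖M‖ * (2 * ‖p‖ / c) := by ring
      linarith
    rw [hsξ]
    have h3 := (hp.le.trans h1)
    rw [le_div_iff₀ (by positivity)] at h3
    linarith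
  · refine differentiableAt_of_leftInverse
      (h.norm_sub_le_of_le_paraboloid (C := ‖M‖ / 2) (fun ζ => ?_) (by positivity)) hT hdT
    linarith [hexp ζ, hupper (ζ - ξ)]

/-- If the subgradient selection is differentiable at `ξ` then `g` has a second-order expansion
there. -/
theorem exists_abs_sub_le (h : IsSubgradientSelection g s) {ξ : E} {X : E →L[ℝ] E}
    (hX : HasFDerivAt s X ξ) {ε : ℝ} (hε : 0 < ε) :
    ∃ δ > 0, ∀ u, ‖u‖ < δ →
      |g (ξ + u) - g ξ - ⟪s ξ, u⟫ - 1 / 2 * ⟪X u, u⟫| ≤ ε * ‖u‖ ^ 2 := by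
  obtain ⟨δ, hδ, hb⟩ := Metric.eventually_nhds_iff.mp (hX.isLittleO.def hε)
  refine ⟨δ, hδ, fun u hu => ?_⟩
  have := abs_sub_sub_le_of_subgradient_affine (G := fun τ => g (ξ + τ • u))
    (S := fun τ => ⟪s (ξ + τ • u), u⟫) (a := ⟪s ξ, u⟫) (b := ⟪X u, u⟫) (η := ε * ‖u‖ ^ 2)
    (fun τ σ => ?_) (fun τ h0 h1 => ?_)
  · simpa using this
  · have := h (ξ + τ • u) (ξ + σ • u)
    rwa [add_sub_add_left_eq_sub, ← sub_smul, real_inner_smul_right] at this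
  · have hn : ‖τ • u‖ ≤ ‖u‖ := by
      rw [norm_smul, Real.norm_of_nonneg h0]
      exact mul_le_of_le_one_left (norm_nonneg u) h1
    have h2 := hb (y := ξ + τ • u) (by simpa using hn.trans_lt hu)
    rw [add_sub_cancel_left] at h2
    have h3 : ⟪s (ξ + τ • u), u⟫ - ⟪s ξ, u⟫ - τ * ⟪X u, u⟫
        = ⟪s (ξ + τ • u) - s ξ - X (τ • u), u⟫ := by
      rw [inner_sub_left, inner_sub_left, map_smul, real_inner_smul_left]
    rw [h3]
    refine (abs_real_inner_le_norm _ _).trans ?_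
    rw [pow_two, ← mul_assoc]
    gcongr
    exact h2.trans (by gcongr)

end IsSubgradientSelection
end ConvexSelection

section SupConvolution

open RealInnerProductSpace

variable {E : Type*} [NormedAddCommGroup E] [InnerProductSpace ℝ E]

theorem IsSubgradientSelection.inner_bounds {g : E → ℝ} {s : E → E}
    (h : IsSubgradientSelection g s) {ξ : E} {X M : E →L[ℝ] E} (hX : HasFDerivAt s X ξ)
    (hM : ∀ ζ, g ζ ≤ g ξ + ⟪s ξ, ζ - ξ⟫ + 1 / 2 * ⟪M (ζ - ξ), ζ - ξ⟫) (u : E) :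
    0 ≤ ⟪X u, u⟫ ∧ ⟪X u, u⟫ ≤ ⟪M u, u⟫ := by
  have key : ∀ ε > 0, -(2 * ε * ‖u‖ ^ 2) ≤ ⟪X u, u⟫ ∧
      ⟪X u, u⟫ ≤ ⟪M u, u⟫ + 2 * ε * ‖u‖ ^ 2 := by
    intro ε hε
    obtain ⟨δ, hδ, hb⟩ := h.exists_abs_sub_le hX hε
    set t := δ / (‖u‖ + 1) / 2
    have ht : 0 < t := by positivity
    have htu : ‖t • u‖ < δ := by
      rw [norm_smul, Real.norm_of_nonneg ht.le]
      have : δ / (‖u‖ + 1) * (‖u‖ + 1) = δ := by field_simp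
      simp only [t]
      nlinarith [norm_nonneg u]
    have h1 := abs_le.mp (hb _ htu)
    have h2 := hM (ξ + t • u)
    have h3 := h ξ (ξ + t • u)
    rw [add_sub_cancel_left] at h2 h3
    simp only [map_smul, real_inner_smul_left, real_inner_smul_right, norm_smul,
      Real.norm_of_nonneg ht.le] at h1 h2 h3
    have ht2 : 0 < t ^ 2 := by positivity
    constructor
    · refine le_of_mul_le_mul_left ?_ ht2
      nlinarith
    · refine le_of_mul_le_mul_left ?_ ht2
      nlinarith
  have hlim : ∀ a : ℝ, Tendsto (fun ε : ℝ => a + 2 * ε * ‖u‖ ^ 2) (𝓝[>] 0) (𝓝 a) := fun a => by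
    have : Continuous fun ε : ℝ => a + 2 * ε * ‖u‖ ^ 2 := by fun_prop
    have := this.tendsto 0
    simp only [mul_zero, zero_mul, add_zero] at this
    exact this.mono_left nhdsWithin_le_nhds
  constructor
  · refine ge_of_tendsto (hlim _) (eventually_nhdsWithin_of_forall fun ε hε => ?_)
    linarith [(key ε hε).1]
  · exact ge_of_tendsto (hlim _) (eventually_nhdsWithin_of_forall fun ε hε => (key ε hε).2)

/-- `(p, Y)` is a second-order superjet of `w` at `x` relative to `K`. -/
def HasSuperjetOn (K : Set E) (w : E → ℝ) (x p : E) (Y : E →L[ℝ] E) : Prop :=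
  ∀ ε > 0, ∃ δ > 0, ∀ u, x + u ∈ K → ‖u‖ < δ →
    w (x + u) - w x ≤ ⟪p, u⟫ + 1 / 2 * ⟪Y u, u⟫ + ε * ‖u‖ ^ 2

/-- `g ξ` is the supremum over `u ∈ K` of `⟪u, ξ⟫ + w u / l - ‖u‖ ^ 2 / 2`, attained at `s ξ`. This
is the sup-convolution of `w` up to a quadratic term and a factor. -/
structure IsConjugate (K : Set E) (w : E → ℝ) (l : ℝ) (g : E → ℝ) (s : E → E) : Prop where
  mem : ∀ ξ, s ξ ∈ K
  eq : ∀ ξ, g ξ = ⟪s ξ, ξ⟫ + l⁻¹ * w (s ξ) - 1 / 2 * ‖s ξ‖ ^ 2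
  le : ∀ ξ, ∀ u ∈ K, ⟪u, ξ⟫ + l⁻¹ * w u - 1 / 2 * ‖u‖ ^ 2 ≤ g ξ

theorem exists_isConjugate {K : Set E} (hK : IsCompact K) (hne : K.Nonempty) {w : E → ℝ}
    (hw : UpperSemicontinuousOn w K) {l : ℝ} (hl : 0 < l) : ∃ g s, IsConjugate K w l g s := by
  have : ∀ ξ : E, ∃ x ∈ K, IsMaxOn (fun u => ⟪u, ξ⟫ + l⁻¹ * w u - 1 / 2 * ‖u‖ ^ 2) K x := by
    intro ξ
    refine UpperSemicontinuousOn.exists_isMaxOn hne hK ?_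
    have h1 : UpperSemicontinuousOn (fun u => l⁻¹ * w u) K := by
      have hc : Continuous fun t : ℝ => l⁻¹ * t := by fun_prop
      have hm : Monotone fun t : ℝ => l⁻¹ * t := fun a b hab => by
        have : 0 < l⁻¹ := by positivity
        dsimp only
        gcongr
      exact hc.comp_upperSemicontinuousOn hw hm
    have h2 : UpperSemicontinuousOn (fun u : E => ⟪u, ξ⟫ - 1 / 2 * ‖u‖ ^ 2) K :=
      ContinuousOn.upperSemicontinuousOn (by fun_prop)
    convert h1.add h2 using 2
    ring
  choose s hs hmax using this
  exact ⟨fun ξ => ⟪s ξ, ξ⟫ + l⁻¹ * w (s ξ) - 1 / 2 * ‖s ξ‖ ^ 2, s, hs, fun _ => rfl,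
    fun ξ u hu => hmax ξ hu⟩

namespace IsConjugate

variable {K : Set E} {w : E → ℝ} {l : ℝ} {g : E → ℝ} {s : E → E}

theorem isSubgradientSelection (h : IsConjugate K w l g s) : IsSubgradientSelection g s := by
  intro a b
  have h1 := h.eq a
  have h2 := h.le b _ (h.mem a)
  rw [inner_sub_right]
  linarith

/-- Superjets of the sup-convolution are superjets of the function at a shifted point. -/
theorem hasSuperjetOn (h : IsConjugate K w l g s) (hl : 0 < l) {ξ : E} {X : E →L[ℝ] E}
    (hX : HasFDerivAt s X ξ) :
    HasSuperjetOn K w (s ξ) (l • (s ξ - ξ)) (l • (X - ContinuousLinearMap.id ℝ E)) := by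
  intro ε hε
  obtain ⟨δ, hδ, hb⟩ := h.isSubgradientSelection.exists_abs_sub_le hX (ε := ε / l) (by positivity)
  refine ⟨δ, hδ, fun u hu hud => ?_⟩
  have h1 := (abs_le.mp (hb u hud)).2
  have h2 := h.le (ξ + u) _ hu
  have h3 := h.eq ξ
  have h4 : l⁻¹ * (w (s ξ + u) - w (s ξ))
      ≤ ⟪s ξ - ξ, u⟫ + 1 / 2 * (⟪X u, u⟫ - ⟪u, u⟫) + ε / l * ‖u‖ ^ 2 := by
    rw [norm_add_sq_real] at h2
    simp only [inner_add_left, inner_add_right, inner_sub_left] at h2 ⊢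
    rw [real_inner_self_eq_norm_sq u] at *
    have := real_inner_comm u ξ
    linarith
  have h5 := mul_le_mul_of_nonneg_left h4 hl.le
  rw [mul_inv_cancel_left₀ hl.ne'] at h5
  refine h5.trans_eq ?_
  simp only [smul_apply, sub_apply,
    ContinuousLinearMap.id_apply, real_inner_smul_left, inner_sub_left]
  field_simp

end IsConjugate

/-- The quadratic form inequality behind the sup-convolution of a quadratic form. -/
theorem inner_le_inner_add_sq {A : E →L[ℝ] E} (hA : ∀ x y, ⟪A x, y⟫ = ⟪x, A y⟫) {ε : ℝ}
    (hε : 0 < ε) (x ξ : E) :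
    ⟪A x, x⟫ ≤ ⟪A ξ, ξ⟫ + ε * ‖A ξ‖ ^ 2 + (1 / ε + ‖A‖) * ‖x - ξ‖ ^ 2 := by
  obtain ⟨u, rfl⟩ : ∃ u, x = ξ + u := ⟨x - ξ, by abel⟩
  rw [add_sub_cancel_left, map_add, inner_add_left, inner_add_right, inner_add_right, hA u ξ,
    real_inner_comm]
  have h1 : ⟪A u, u⟫ ≤ ‖A‖ * ‖u‖ ^ 2 := by
    refine (real_inner_le_norm _ _).trans ?_
    rw [pow_two, ← mul_assoc]
    gcongr
    exact A.le_opNorm u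
  have h2 : 2 * ⟪A ξ, u⟫ ≤ ε * ‖A ξ‖ ^ 2 + 1 / ε * ‖u‖ ^ 2 := by
    have h3 := real_inner_le_norm (A ξ) u
    have h4 : ε * ‖A ξ‖ ^ 2 + 1 / ε * ‖u‖ ^ 2 - 2 * (‖A ξ‖ * ‖u‖)
        = (ε * ‖A ξ‖ - ‖u‖) ^ 2 / ε := by field_simp; ring
    have : 0 ≤ (ε * ‖A ξ‖ - ‖u‖) ^ 2 / ε := by positivity
    linarith
  have h5 : ⟪u, A ξ⟫ = ⟪A ξ, u⟫ := real_inner_comm _ _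
  have h6 : ⟪ξ, A ξ⟫ = ⟪A ξ, ξ⟫ := real_inner_comm _ _
  linarith

end SupConvolution

section Product

open RealInnerProductSpace WithLp

variable {ι : Type*} [Fintype ι] {E : ι → Type*} [∀ i, NormedAddCommGroup (E i)]
  [∀ i, InnerProductSpace ℝ (E i)]

theorem DifferentiableAt.of_toLp_apply {s : ∀ i, E i → E i} {ξ : PiLp 2 E}
    (h : DifferentiableAt ℝ (fun ζ : PiLp 2 E => (toLp 2 fun i => s i (ζ i) : PiLp 2 E)) ξ)
    (i : ι) : DifferentiableAt ℝ (s i) (ξ i) := by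
  classical
  let L : E i →L[ℝ] PiLp 2 E :=
    ((PiLp.continuousLinearEquiv 2 ℝ E).symm : (∀ i, E i) →L[ℝ] PiLp 2 E) ∘L
      ContinuousLinearMap.single ℝ E i
  have hL : ∀ a, (L a) i = a := fun a => by simp [L]
  have h1 := differentiableAt_piLp 2 |>.mp h i
  have h2 : DifferentiableAt ℝ (fun a : E i => ξ + L (a - ξ i)) (ξ i) := by fun_prop
  have h3 : ξ = ξ + L (ξ i - ξ i) := by simp
  rw [h3] at h1
  have h4 := DifferentiableAt.comp (ξ i) h1 h2
  refine h4.congr_of_eventuallyEq (Eventually.of_forall fun a => ?_)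
  simp [hL]

theorem hasFDerivAt_toLp_apply {s : ∀ i, E i → E i} {ξ : PiLp 2 E} {X : ∀ i, E i →L[ℝ] E i}
    (h : ∀ i, HasFDerivAt (s i) (X i) (ξ i)) :
    HasFDerivAt (fun ζ : PiLp 2 E => (toLp 2 fun i => s i (ζ i) : PiLp 2 E))
      (((PiLp.continuousLinearEquiv 2 ℝ E).symm : (∀ i, E i) →L[ℝ] PiLp 2 E) ∘L
        ContinuousLinearMap.pi fun i => X i ∘L PiLp.proj 2 E i) ξ := by
  refine (PiLp.hasFDerivAt_toLp 2 _).comp ξ (hasFDerivAt_pi.mpr fun i => ?_)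
  exact (h i).comp ξ (PiLp.hasFDerivAt_apply 2 ξ i)

/-- The maximum principle for a sum touched from above by a quadratic form, before passing to the
limit. -/
theorem exists_hasSuperjetOn_of_sum_le_quadratic [∀ i, FiniteDimensional ℝ (E i)]
    {K : ∀ i, Set (E i)} (hK : ∀ i, IsCompact (K i)) {w : ∀ i, E i → ℝ}
    (hw : ∀ i, UpperSemicontinuousOn (w i) (K i)) (hK0 : ∀ i, 0 ∈ K i) (hw0 : ∀ i, w i 0 = 0)
    {A : PiLp 2 E →L[ℝ] PiLp 2 E} (hA : ∀ x y, ⟪A x, y⟫ = ⟪x, A y⟫)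
    (hle : ∀ u : PiLp 2 E, (∀ i, u i ∈ K i) → ∑ i, w i (u i) ≤ 1 / 2 * ⟪A u, u⟫)
    {ε δ : ℝ} (hε : 0 < ε) (hδ : 0 < δ) :
    ∃ (x p : PiLp 2 E) (Y : ∀ i, E i →L[ℝ] E i), (∀ i, x i ∈ K i) ∧ ‖x‖ ≤ δ ∧ ‖p‖ ≤ δ ∧
      (∀ i, HasSuperjetOn (K i) (w i) (x i) (p i) (Y i)) ∧
      ∀ h : PiLp 2 E, -((1 / ε + ‖A‖) * ‖h‖ ^ 2) ≤ ∑ i, ⟪Y i (h i), h i⟫ ∧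
        ∑ i, ⟪Y i (h i), h i⟫ ≤ ⟪A h, h⟫ + ε * ‖A h‖ ^ 2 + δ * ‖h‖ ^ 2 := by
  set l := 1 / ε + ‖A‖
  have hl : 0 < l := by positivity
  choose g s hgs using fun i => exists_isConjugate (hK i) ⟨0, hK0 i⟩ (hw i) hl
  let gt : PiLp 2 E → ℝ := fun ξ => ∑ i, g i (ξ i)
  let st : PiLp 2 E → PiLp 2 E := fun ξ => toLp 2 fun i => s i (ξ i)
  have hsub : IsSubgradientSelection gt st := fun a b => by
    simp only [gt, st, PiLp.inner_apply, ← Finset.sum_add_distrib]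
    exact Finset.sum_le_sum fun i _ => (hgs i).isSubgradientSelection _ _
  have hgt : ∀ ξ, gt ξ = ⟪st ξ, ξ⟫ + l⁻¹ * ∑ i, w i (st ξ i) - 1 / 2 * ‖st ξ‖ ^ 2 := fun ξ => by
    simp only [gt, st, PiLp.inner_apply, PiLp.norm_sq_eq_of_L2, Finset.mul_sum,
      ← Finset.sum_add_distrib, ← Finset.sum_sub_distrib]
    exact Finset.sum_congr rfl fun i _ => (hgs i).eq _
  set c := δ / l
  have hc : 0 < c := by positivity
  have hlc : l * c = δ := by simp only [c]; field_simp
  let I := ContinuousLinearMap.id ℝ (PiLp 2 E)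
  let M : PiLp 2 E →L[ℝ] PiLp 2 E := (1 + c) • I + l⁻¹ • (A + ε • A ∘L A)
  have hMf : ∀ ξ, ⟪M ξ, ξ⟫ = (1 + c) * ‖ξ‖ ^ 2 + l⁻¹ * (⟪A ξ, ξ⟫ + ε * ‖A ξ‖ ^ 2) := fun ξ => by
    simp only [M, I, add_apply, smul_apply,
      ContinuousLinearMap.comp_apply, ContinuousLinearMap.id_apply, inner_add_left,
      real_inner_smul_left, real_inner_self_eq_norm_sq, hA (A ξ) ξ]
  have hMs : ∀ x y, ⟪M x, y⟫ = ⟪x, M y⟫ := fun x y => by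
    simp only [M, I, add_apply, smul_apply,
      ContinuousLinearMap.comp_apply, ContinuousLinearMap.id_apply, inner_add_left,
      inner_add_right, real_inner_smul_left, real_inner_smul_right, hA]
  have hle' : ∀ ξ, gt ξ ≤ 1 / 2 * ⟪M ξ, ξ⟫ - c / 2 * ‖ξ‖ ^ 2 := fun ξ => by
    have h1 := hle (st ξ) fun i => (hgs i).mem _
    have h2 := inner_le_inner_add_sq hA hε (st ξ) ξ
    have h3 : l⁻¹ * ∑ i, w i (st ξ i) ≤ l⁻¹ * (1 / 2 * (⟪A ξ, ξ⟫ + ε * ‖A ξ‖ ^ 2))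
        + 1 / 2 * ‖st ξ - ξ‖ ^ 2 := by
      have h4 : ∑ i, w i (st ξ i) ≤ 1 / 2 * (⟪A ξ, ξ⟫ + ε * ‖A ξ‖ ^ 2)
          + l * (1 / 2 * ‖st ξ - ξ‖ ^ 2) := by linarith
      refine (mul_le_mul_of_nonneg_left h4 (by positivity : 0 ≤ l⁻¹)).trans_eq ?_
      rw [mul_add, inv_mul_cancel_left₀ hl.ne']
    rw [norm_sub_sq_real] at h3
    rw [hgt, hMf]
    linarith
  have hg0 : gt 0 = 0 := by
    refine le_antisymm (by simpa using hle' 0) (Finset.sum_nonneg fun i _ => ?_)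
    simpa [hw0] using (hgs i).le 0 0 (hK0 i)
  obtain ⟨ξ, hξ, hsξ, hd, htouch⟩ := hsub.exists_differentiableAt_touching hMs hc hg0 hle'
    (δ := min δ (δ / (2 * l))) (by positivity)
  have hX := fun i => (DifferentiableAt.of_toLp_apply hd i).hasFDerivAt
  have hXt := hasFDerivAt_toLp_apply hX
  refine ⟨st ξ, l • (st ξ - ξ), fun i => l • (fderiv ℝ (s i) (ξ i) - ContinuousLinearMap.id ℝ _),
    fun i => (hgs i).mem _, hsξ.trans (min_le_left _ _), ?_,
    fun i => (hgs i).hasSuperjetOn hl (hX i), fun h => ?_⟩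
  · rw [norm_smul, Real.norm_of_nonneg hl.le]
    have h1 := (norm_sub_le (st ξ) ξ)
    have h2 : min δ (δ / (2 * l)) ≤ δ / (2 * l) := min_le_right _ _
    have h3 : l * (δ / (2 * l)) = δ / 2 := by field_simp
    nlinarith
  · have h1 := hsub.inner_bounds hXt htouch h
    have h2 : ∑ i, ⟪(l • (fderiv ℝ (s i) (ξ i) - ContinuousLinearMap.id ℝ (E i))) (h i), h i⟫
        = l * (∑ i, ⟪fderiv ℝ (s i) (ξ i) (h i), h i⟫ - ‖h‖ ^ 2) := by
      simp only [PiLp.norm_sq_eq_of_L2, smul_apply,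
        sub_apply, ContinuousLinearMap.id_apply, real_inner_smul_left,
        inner_sub_left, real_inner_self_eq_norm_sq, ← Finset.mul_sum, Finset.sum_sub_distrib]
    have h3 : ⟪((((PiLp.continuousLinearEquiv 2 ℝ E).symm : (∀ i, E i) →L[ℝ] PiLp 2 E) ∘L
        ContinuousLinearMap.pi fun i => fderiv ℝ (s i) (ξ i) ∘L PiLp.proj 2 E i)) h, h⟫
        = ∑ i, ⟪fderiv ℝ (s i) (ξ i) (h i), h i⟫ := by
      rw [PiLp.inner_apply]; rfl
    rw [h3, hMf] at h1
    rw [h2]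
    constructor
    · nlinarith [h1.1]
    · have h4 := mul_le_mul_of_nonneg_left h1.2 hl.le
      rw [mul_add, mul_inv_cancel_left₀ hl.ne', ← mul_assoc, mul_add, mul_one, hlc] at h4
      linarith

end Product

section Localization

open RealInnerProductSpace

/-- Second-order Taylor expansion of a function which is `C²` at a point. -/
theorem ContDiffAt.eventually_abs_sub_le {E : Type*} [NormedAddCommGroup E] [NormedSpace ℝ E]
    {φ : E → ℝ} {x : E} (hφ : ContDiffAt ℝ 2 φ x) {η : ℝ} (hη : 0 < η) :
    ∀ᶠ u in 𝓝 0, |φ (x + u) - φ x - fderiv ℝ φ x u - 1 / 2 * fderiv ℝ (fderiv ℝ φ) x u u|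
      ≤ η * ‖u‖ ^ 2 := by
  set B := fderiv ℝ (fderiv ℝ φ) x
  have hsymm : ∀ a b, B a b = B b a := hφ.isSymmSndFDerivAt (by simp)
  have hd : HasFDerivAt (fderiv ℝ φ) B x :=
    ((hφ.fderiv_right (m := 1) (by norm_num)).differentiableAt (by norm_num)).hasFDerivAt
  have hev : ∀ᶠ y in 𝓝 x, DifferentiableAt ℝ φ y := by
    filter_upwards [hφ.eventually (by simp)] with y hy
    exact hy.differentiableAt (by norm_num)
  obtain ⟨δ, hδ, hb⟩ := Metric.eventually_nhds_iff.mp (hev.and (hd.isLittleO.def hη))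
  refine Metric.eventually_nhds_iff.mpr ⟨δ, hδ, fun u hu => ?_⟩
  rw [dist_zero_right] at hu
  let r : E → ℝ := fun a => φ (x + a) - φ x - fderiv ℝ φ x a - 1 / 2 * B a a
  have hr : ∀ a ∈ Metric.closedBall (0 : E) ‖u‖, HasFDerivWithinAt r
      (fderiv ℝ φ (x + a) - fderiv ℝ φ x - B a) (Metric.closedBall (0 : E) ‖u‖) a := by
    intro a ha
    have ha' : ‖a‖ ≤ ‖u‖ := by simpa using ha
    have h1 := (hb (y := x + a) (by simpa using ha'.trans_lt hu)).1.hasFDerivAt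
    have h2 : HasFDerivAt (fun a => φ (x + a)) (fderiv ℝ φ (x + a)) a :=
      (hasFDerivAt_comp_add_left x).mpr h1
    have h3 := ((B.hasFDerivAt (x := a)).clm_apply (hasFDerivAt_id a)).const_mul (1 / 2 : ℝ)
    have h4 := ((h2.sub_const (φ x)).sub (fderiv ℝ φ x).hasFDerivAt).sub h3
    refine (h4.congr_fderiv ?_).hasFDerivWithinAt
    ext c
    simp [hsymm c a]
    ring
  have hbound : ∀ a ∈ Metric.closedBall (0 : E) ‖u‖,
      ‖fderiv ℝ φ (x + a) - fderiv ℝ φ x - B a‖ ≤ η * ‖u‖ := by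
    intro a ha
    have ha' : ‖a‖ ≤ ‖u‖ := by simpa using ha
    have h1 := (hb (y := x + a) (by simpa using ha'.trans_lt hu)).2
    rw [add_sub_cancel_left] at h1
    exact h1.trans (by gcongr)
  have := (convex_closedBall (0 : E) ‖u‖).norm_image_sub_le_of_norm_hasFDerivWithin_le hr hbound
    (Metric.mem_closedBall_self (norm_nonneg u)) (y := u) (by simp)
  simp only [r, sub_zero, add_zero, map_zero, sub_self, mul_zero, Real.norm_eq_abs] at this
  rw [pow_two, ← mul_assoc]
  exact this

/-- Every bounded bilinear form on a finite-dimensional inner product space is represented by an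
operator. -/
theorem ContinuousLinearMap.exists_inner_eq {E : Type*} [NormedAddCommGroup E]
    [InnerProductSpace ℝ E] [FiniteDimensional ℝ E] (B : E →L[ℝ] E →L[ℝ] ℝ) :
    ∃ A : E →L[ℝ] E, ∀ x y, ⟪A x, y⟫ = B x y := by
  let b := stdOrthonormalBasis ℝ E
  refine ⟨∑ k, (B.flip (b k)).smulRight (b k), fun x y => ?_⟩
  conv_rhs => rw [← b.sum_repr' y, map_sum]
  simp only [sum_apply, ContinuousLinearMap.smulRight_apply, sum_inner,
    real_inner_smul_left, map_smul, smul_eq_mul, ContinuousLinearMap.flip_apply]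
  exact Finset.sum_congr rfl fun k _ => mul_comm _ _

theorem HasSuperjetOn.of_mem_nhdsWithin {E : Type*} [NormedAddCommGroup E] [InnerProductSpace ℝ E]
    {K O : Set E} {w : E → ℝ} {x p : E} {Y : E →L[ℝ] E} (h : HasSuperjetOn K w x p Y)
    (hK : K ∈ 𝓝[O] x) : HasSuperjetOn O w x p Y := by
  intro ε hε
  obtain ⟨δ, hδ, hb⟩ := h ε hε
  obtain ⟨r, hr, hrK⟩ := Metric.mem_nhdsWithin_iff.mp hK
  refine ⟨min δ r, by positivity, fun u hu hud => hb u (hrK ⟨?_, hu⟩) ?_⟩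
  · simpa using hud.trans_le (min_le_right _ _)
  · exact hud.trans_le (min_le_left _ _)

variable {ι : Type*} [Fintype ι] {E : ι → Type*} [∀ i, NormedAddCommGroup (E i)]
  [∀ i, InnerProductSpace ℝ (E i)]

/-- The maximum principle for a sum with a second-order bound from above at the origin, before
passing to the limit. -/
theorem exists_hasSuperjetOn_of_eventually_sum_le [∀ i, FiniteDimensional ℝ (E i)]
    {O : ∀ i, Set (E i)}
    (hO : ∀ i, ∀ U ∈ 𝓝 (0 : E i), ∃ K ⊆ U ∩ O i, IsCompact K ∧ K ∈ 𝓝[O i] 0)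
    {w : ∀ i, E i → ℝ} (hw : ∀ i, UpperSemicontinuousOn (w i) (O i)) (hO0 : ∀ i, 0 ∈ O i)
    (hw0 : ∀ i, w i 0 = 0)
    {A : PiLp 2 E →L[ℝ] PiLp 2 E} (hA : ∀ x y, ⟪A x, y⟫ = ⟪x, A y⟫)
    (hle : ∀ η > 0, ∀ᶠ u : PiLp 2 E in 𝓝 0, (∀ i, u i ∈ O i) →
      ∑ i, w i (u i) ≤ 1 / 2 * ⟪A u, u⟫ + η * ‖u‖ ^ 2)
    {ε δ : ℝ} (hε : 0 < ε) (hδ : 0 < δ) :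
    ∃ (x p : PiLp 2 E) (Y : ∀ i, E i →L[ℝ] E i), (∀ i, x i ∈ O i) ∧ ‖x‖ ≤ δ ∧ ‖p‖ ≤ δ ∧
      (∀ i, HasSuperjetOn (O i) (w i) (x i) (p i) (Y i)) ∧
      ∀ h : PiLp 2 E, -((1 / ε + ‖A‖ + 1) * ‖h‖ ^ 2) ≤ ∑ i, ⟪Y i (h i), h i⟫ ∧
        ∑ i, ⟪Y i (h i), h i⟫ ≤ ⟪A h, h⟫ + ε * ‖A h‖ ^ 2 + δ * ‖h‖ ^ 2 := by
  set κ := 1 + ε * (2 * ‖A‖ + 1)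
  have hκ : 0 < κ := by positivity
  set η := min 1 (δ / (2 * κ))
  have hη : 0 < η := by positivity
  have hη1 : η ≤ 1 := min_le_left _ _
  have hηκ : η * κ ≤ δ / 2 := by
    have h1 : η ≤ δ / (2 * κ) := min_le_right _ _
    calc η * κ ≤ δ / (2 * κ) * κ := by gcongr
      _ = δ / 2 := by field_simp
  have hev : ∀ᶠ u : ∀ i, E i in 𝓝 0, (∀ i, u i ∈ O i) →
      ∑ i, w i (u i) ≤ 1 / 2 * ⟪A (WithLp.toLp 2 u), WithLp.toLp 2 u⟫
        + η / 2 * ‖WithLp.toLp 2 u‖ ^ 2 := by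
    have hc : Tendsto (fun u : ∀ i, E i => (WithLp.toLp 2 u : PiLp 2 E)) (𝓝 0) (𝓝 0) :=
      (PiLp.continuous_toLp 2 E).tendsto 0
    exact hc.eventually (hle (η / 2) (by positivity))
  rw [nhds_pi] at hev
  obtain ⟨J, U, hU, hUev⟩ := Filter.mem_pi'.mp hev
  choose K hKU hK hKO using fun i => hO i (U i) (hU i)
  have hKr : ∀ i, ∃ r > 0, Metric.ball 0 r ∩ O i ⊆ K i := fun i =>
    Metric.mem_nhdsWithin_iff.mp (hKO i)
  choose r hr hrK using hKr
  obtain ⟨ρ, hρ, hρ0⟩ := ((eventually_all.mpr fun i => eventually_nhdsWithin_of_eventually_nhds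
    (eventually_lt_nhds (hr i)) : ∀ᶠ ρ : ℝ in 𝓝[>] 0, ∀ i, ρ < r i).and self_mem_nhdsWithin).exists
  have hρ0 : 0 < ρ := hρ0
  have hmem : ∀ i, 0 ∈ K i := fun i => hrK i ⟨Metric.mem_ball_self (hr i), hO0 i⟩
  set A' : PiLp 2 E →L[ℝ] PiLp 2 E := A + η • ContinuousLinearMap.id ℝ _
  have hA'x : ∀ x, A' x = A x + η • x := fun x => rfl
  have hA' : ∀ x y, ⟪A' x, y⟫ = ⟪x, A' y⟫ := fun x y => by
    simp only [hA'x, inner_add_left, inner_add_right, real_inner_smul_left, real_inner_smul_right,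
      hA]
  have hA'n : ‖A'‖ ≤ ‖A‖ + 1 := by
    refine ContinuousLinearMap.opNorm_le_bound _ (by positivity) fun x => ?_
    rw [hA'x, add_mul, one_mul]
    refine (norm_add_le _ _).trans (add_le_add (A.le_opNorm x) ?_)
    rw [norm_smul, Real.norm_of_nonneg hη.le]
    exact mul_le_of_le_one_left (norm_nonneg _) hη1
  obtain ⟨x, p, Y, hxK, hx, hp, hjet, hY⟩ := exists_hasSuperjetOn_of_sum_le_quadratic hK
    (fun i => (hw i).mono ((hKU i).trans inter_subset_right)) hmem hw0 hA'
    (fun u hu => by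
      have h1 : WithLp.ofLp u ∈ (J : Set ι).pi U := fun i _ => (hKU i (hu i)).1
      have h2 := hUev h1 fun i => (hKU i (hu i)).2
      rw [hA'x, inner_add_left, real_inner_smul_left, real_inner_self_eq_norm_sq]
      simp only [WithLp.toLp_ofLp] at h2
      linarith) hε (δ := min (δ / 2) ρ) (by positivity)
  have hδ2 : min (δ / 2) ρ ≤ δ / 2 := min_le_left _ _
  refine ⟨x, p, Y, fun i => (hKU i (hxK i)).2, by linarith, by linarith, fun i => ?_, fun h => ?_⟩
  · refine (hjet i).of_mem_nhdsWithin (Metric.mem_nhdsWithin_iff.mpr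
      ⟨r i - ρ, by linarith [hρ i], fun y hy => hrK i ⟨?_, hy.2⟩⟩)
    have h1 : ‖x i‖ ≤ ρ := (PiLp.norm_apply_le x i).trans (hx.trans (min_le_right _ _))
    have h2 := hy.1
    rw [Metric.mem_ball, dist_eq_norm] at h2
    rw [Metric.mem_ball, dist_zero_right]
    calc ‖y‖ = ‖(y - x i) + x i‖ := by rw [sub_add_cancel]
      _ ≤ ‖y - x i‖ + ‖x i‖ := norm_add_le _ _
      _ < r i := by linarith
  · obtain ⟨h1, h2⟩ := hY h
    constructor
    · refine le_trans (neg_le_neg ?_) h1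
      exact mul_le_mul_of_nonneg_right (by linarith) (sq_nonneg _)
    · refine h2.trans ?_
      have h3 : ⟪A h, h⟫ ≤ ‖A‖ * ‖h‖ ^ 2 := by
        refine (real_inner_le_norm _ _).trans ?_
        rw [pow_two, ← mul_assoc]
        gcongr
        exact A.le_opNorm h
      have h4 : ‖A' h‖ ^ 2 ≤ ‖A h‖ ^ 2 + η * (2 * ‖A‖ + 1) * ‖h‖ ^ 2 := by
        rw [hA'x, norm_add_sq_real, real_inner_smul_right, norm_smul, Real.norm_of_nonneg hη.le]
        have h5 : η * η ≤ η * 1 := by gcongr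
        nlinarith [mul_le_mul_of_nonneg_left h3 hη.le,
          mul_le_mul_of_nonneg_right h5 (sq_nonneg ‖h‖)]
      have h5 := mul_le_mul_of_nonneg_left h4 hε.le
      have h6 : (η * κ) * ‖h‖ ^ 2 ≤ δ / 2 * ‖h‖ ^ 2 := by gcongr
      have h7 : min (δ / 2) ρ * ‖h‖ ^ 2 ≤ δ / 2 * ‖h‖ ^ 2 := by gcongr
      rw [hA'x, inner_add_left, real_inner_smul_left, real_inner_self_eq_norm_sq]
      rw [hA'x] at h5
      simp only [κ] at h6
      linarith

end Localization

section Coordinates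

open RealInnerProductSpace

theorem exists_isCompact_mem_nhdsWithin {X : Type*} [TopologicalSpace X] {S : Set X}
    [LocallyCompactSpace S] {x : X} (hx : x ∈ S) {U : Set X} (hU : U ∈ 𝓝 x) :
    ∃ K ⊆ U ∩ S, IsCompact K ∧ K ∈ 𝓝[S] x := by
  obtain ⟨K, hK, hKU, hKc⟩ := LocallyCompactSpace.local_compact_nhds (⟨x, hx⟩ : S) _
    (continuous_subtype_val.continuousAt.preimage_mem_nhds hU)
  refine ⟨Subtype.val '' K, ?_, hKc.image continuous_subtype_val, ?_⟩
  · rintro _ ⟨y, hy, rfl⟩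
    exact ⟨hKU hy, y.2⟩
  · rw [nhdsWithin_eq_map_subtype_coe hx]
    exact image_mem_map hK

theorem enormV_eq_norm {n : ℕ} (h : Fin n → ℝ) :
    enormV h = ‖(WithLp.toLp 2 h : EuclideanSpace ℝ (Fin n))‖ := by
  simp [enormV, EuclideanSpace.norm_eq]

/-- The matrix of the symmetric part of an operator. -/
def symMatrix {n : ℕ} (Y : EuclideanSpace ℝ (Fin n) →L[ℝ] EuclideanSpace ℝ (Fin n)) :
    Matrix (Fin n) (Fin n) ℝ :=
  Matrix.of fun j l => 1 / 2 * (Y (EuclideanSpace.single j 1) l + Y (EuclideanSpace.single l 1) j)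

variable {n : ℕ} (Y : EuclideanSpace ℝ (Fin n) →L[ℝ] EuclideanSpace ℝ (Fin n))

theorem symMatrix_isSymm : (symMatrix Y).IsSymm := by
  ext j l
  simp [symMatrix, add_comm]

theorem sum_symMatrix (h : EuclideanSpace ℝ (Fin n)) :
    ∑ j, ∑ l, symMatrix Y j l * h j * h l = ⟪Y h, h⟫ := by
  have h1 : ∑ j, ∑ l, Y (EuclideanSpace.single j 1) l * h j * h l = ⟪Y h, h⟫ := by
    have h2 : h = ∑ j, h j • EuclideanSpace.single j (1 : ℝ) := by
      ext l
      simp [Pi.single_apply]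
    conv_rhs => rw [h2, map_sum, ← h2, sum_inner]
    refine Finset.sum_congr rfl fun j _ => ?_
    rw [map_smul, real_inner_smul_left, PiLp.inner_apply, Finset.mul_sum]
    refine Finset.sum_congr rfl fun l _ => ?_
    simp only [RCLike.inner_apply, conj_trivial]
    ring
  have h2 : ∑ j, ∑ l, Y (EuclideanSpace.single l 1) j * h j * h l = ⟪Y h, h⟫ := by
    rw [Finset.sum_comm, ← h1]
    exact Finset.sum_congr rfl fun j _ => Finset.sum_congr rfl fun l _ => by ring
  calc ∑ j, ∑ l, symMatrix Y j l * h j * h l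
      = 1 / 2 * (∑ j, ∑ l, Y (EuclideanSpace.single j 1) l * h j * h l
        + ∑ j, ∑ l, Y (EuclideanSpace.single l 1) j * h j * h l) := by
        simp only [symMatrix, Matrix.of_apply, Finset.mul_sum, ← Finset.sum_add_distrib]
        exact Finset.sum_congr rfl fun j _ => Finset.sum_congr rfl fun l _ => by ring
    _ = ⟪Y h, h⟫ := by rw [h1, h2]; ring

theorem abs_symMatrix_le {C : ℝ} (hY : ∀ h, |⟪Y h, h⟫| ≤ C * ‖h‖ ^ 2) (j l : Fin n) :
    |symMatrix Y j l| ≤ 3 * C := by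
  set a : EuclideanSpace ℝ (Fin n) := EuclideanSpace.single j 1
  set b : EuclideanSpace ℝ (Fin n) := EuclideanSpace.single l 1
  have ha : ‖a‖ = 1 := by simp [a]
  have hb : ‖b‖ = 1 := by simp [b]
  have hC : 0 ≤ C := by simpa [ha] using (abs_nonneg _).trans (hY a)
  have hab : ‖a + b‖ ≤ 2 := (norm_add_le a b).trans (by rw [ha, hb]; norm_num)
  have h1 : symMatrix Y j l = 1 / 2 * (⟪Y (a + b), a + b⟫ - ⟪Y a, a⟫ - ⟪Y b, b⟫) := by
    have h2 : ⟪Y a, b⟫ = Y a l := by simp [b, EuclideanSpace.inner_single_right]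
    have h3 : ⟪Y b, a⟫ = Y b j := by simp [a, EuclideanSpace.inner_single_right]
    rw [map_add, inner_add_left, inner_add_right, inner_add_right, h2, h3]
    simp only [symMatrix, Matrix.of_apply, a, b]
    ring
  have h2 := abs_le.mp (hY (a + b))
  have h3 := abs_le.mp (hY a)
  have h4 := abs_le.mp (hY b)
  rw [ha] at h3
  rw [hb] at h4
  have h5 : C * ‖a + b‖ ^ 2 ≤ C * 2 ^ 2 := by gcongr
  rw [h1, abs_le]
  constructor <;> linarith

variable {Y} in
theorem HasSuperjetOn.mem_superjet {O : Set (Fin n → ℝ)} {w : (Fin n → ℝ) → ℝ}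
    {z q : Fin n → ℝ} {x p : EuclideanSpace ℝ (Fin n)}
    (h : HasSuperjetOn {u : EuclideanSpace ℝ (Fin n) | z + u.ofLp ∈ O}
      (fun u => w (z + u.ofLp) - w z - ∑ j, q j * u j) x p Y) :
    (q + p.ofLp, symMatrix Y) ∈ superjet O w (z + x.ofLp) := by
  refine ⟨symMatrix_isSymm Y, fun ε hε => ?_⟩
  obtain ⟨δ, hδ, hb⟩ := h ε hε
  refine ⟨δ, hδ, fun u hu hud => ?_⟩
  rw [enormV_eq_norm] at hud ⊢
  have h1 := hb (WithLp.toLp 2 u) (by simpa [add_assoc] using hu) hud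
  have h2 := sum_symMatrix Y (WithLp.toLp 2 u)
  have h3 : ⟪p, (WithLp.toLp 2 u : EuclideanSpace ℝ (Fin n))⟫ = ∑ j, p j * u j := by
    simp [PiLp.inner_apply, mul_comm]
  simp only [WithLp.ofLp_add, PiLp.add_apply, mul_add, Finset.sum_add_distrib, Pi.add_apply,
    add_mul, ← add_assoc] at h1 h2 ⊢
  rw [h2]
  linarith

end Coordinates

section ProductCoordinates

open RealInnerProductSpace

variable {k : ℕ} {N : Fin k → ℕ}

theorem sum_smul_coordVec (z : ∀ i, Fin (N i) → ℝ) :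
    ∑ a : Σ i, Fin (N i), z a.1 a.2 • coordVec a = z := by
  ext i j
  rw [Fintype.sum_sigma]
  simp only [coordVec, Finset.sum_apply, Pi.smul_apply, smul_eq_mul]
  rw [Finset.sum_eq_single i, Finset.sum_eq_single j]
  · simp
  · intro l _ hl
    simp [hl.symm]
  · simp
  · intro i' _ hi
    simp [hi.symm]
  · simp

theorem hessMat_apply (φ : (∀ i, Fin (N i) → ℝ) → ℝ) (xb : ∀ i, Fin (N i) → ℝ)
    (a c : Σ i, Fin (N i)) :
    hessMat φ xb a c = fderiv ℝ (fderiv ℝ φ) xb (coordVec a) (coordVec c) := by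
  simp [hessMat, iteratedFDeriv_two_apply]

theorem hessMat_isSymm {φ : (∀ i, Fin (N i) → ℝ) → ℝ} {xb : ∀ i, Fin (N i) → ℝ}
    (hφ : ContDiffAt ℝ 2 φ xb) : (hessMat φ xb).IsSymm := by
  have hsymm : ∀ a b, fderiv ℝ (fderiv ℝ φ) xb a b = fderiv ℝ (fderiv ℝ φ) xb b a :=
    hφ.isSymmSndFDerivAt (by simp)
  ext a c
  simp only [Matrix.transpose_apply, hessMat_apply, hsymm (coordVec c)]

theorem fderiv_fderiv_eq_dotProduct (φ : (∀ i, Fin (N i) → ℝ) → ℝ) (xb : ∀ i, Fin (N i) → ℝ)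
    (x y : ∀ i, Fin (N i) → ℝ) :
    fderiv ℝ (fderiv ℝ φ) xb x y = (fun a : Σ i, Fin (N i) => x a.1 a.2) ⬝ᵥ
      (hessMat φ xb).mulVec fun a => y a.1 a.2 := by
  conv_lhs => rw [← sum_smul_coordVec x, ← sum_smul_coordVec y]
  simp only [map_sum, map_smul, sum_apply, smul_apply, smul_eq_mul, dotProduct, Matrix.mulVec,
    hessMat_apply, Finset.mul_sum]
  rw [Finset.sum_comm]
  exact Finset.sum_congr rfl fun a _ => Finset.sum_congr rfl fun c _ => by ring

theorem dotProduct_blockDiag_mulVec (X : ∀ i, Matrix (Fin (N i)) (Fin (N i)) ℝ)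
    (x : (Σ i, Fin (N i)) → ℝ) :
    x ⬝ᵥ (blockDiag X).mulVec x = ∑ i, ∑ j, ∑ l, X i j l * x ⟨i, j⟩ * x ⟨i, l⟩ := by
  simp only [dotProduct, Matrix.mulVec, Fintype.sum_sigma]
  refine Finset.sum_congr rfl fun i _ => Finset.sum_congr rfl fun j _ => ?_
  rw [Finset.sum_eq_single i, Finset.mul_sum]
  · exact Finset.sum_congr rfl fun l _ => by simp [blockDiag]; ring
  · intro i' _ hi
    simp [blockDiag, hi.symm]
  · simp

theorem blockDiag_isSymm {X : ∀ i, Matrix (Fin (N i)) (Fin (N i)) ℝ} (hX : ∀ i, (X i).IsSymm) :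
    (blockDiag X).IsSymm := by
  ext ⟨i, j⟩ ⟨i', l⟩
  by_cases h : i = i'
  · subst h
    simpa [blockDiag] using (hX i).apply _ _
  · simp [blockDiag, h, Ne.symm h]

/-- The linear map from the Euclidean product to the plain product of coordinate spaces. -/
def toCoord (N : Fin k → ℕ) :
    PiLp 2 (fun i => EuclideanSpace ℝ (Fin (N i))) →L[ℝ] ∀ i, Fin (N i) → ℝ :=
  ContinuousLinearMap.pi fun i =>
    (EuclideanSpace.equiv (Fin (N i)) ℝ : _ →L[ℝ] _) ∘L PiLp.proj 2 _ i

theorem toCoord_apply (u : PiLp 2 fun i => EuclideanSpace ℝ (Fin (N i))) (i : Fin k) :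
    toCoord N u i = (u i).ofLp := rfl

/-- The Hessian as an operator on the Euclidean product. -/
theorem exists_hessian_operator {φ : (∀ i, Fin (N i) → ℝ) → ℝ} {xb : ∀ i, Fin (N i) → ℝ}
    (hφ : ContDiffAt ℝ 2 φ xb) :
    ∃ A : PiLp 2 (fun i => EuclideanSpace ℝ (Fin (N i))) →L[ℝ]
        PiLp 2 fun i => EuclideanSpace ℝ (Fin (N i)),
      (∀ x y, ⟪A x, y⟫ = fderiv ℝ (fderiv ℝ φ) xb (toCoord N x) (toCoord N y)) ∧
      (∀ x y, ⟪A x, y⟫ = ⟪x, A y⟫) ∧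
      ∀ h ε, (fun a : Σ i, Fin (N i) => h a.1 a.2) ⬝ᵥ
        (hessMat φ xb + ε • (hessMat φ xb * hessMat φ xb)).mulVec (fun a => h a.1 a.2)
          = ⟪A h, h⟫ + ε * ‖A h‖ ^ 2 := by
  have hsymm : ∀ a b, fderiv ℝ (fderiv ℝ φ) xb a b = fderiv ℝ (fderiv ℝ φ) xb b a :=
    hφ.isSymmSndFDerivAt (by simp)
  obtain ⟨A, hA⟩ := ContinuousLinearMap.exists_inner_eq
    ((fderiv ℝ (fderiv ℝ φ) xb).bilinearComp (toCoord N) (toCoord N))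
  simp only [ContinuousLinearMap.bilinearComp_apply] at hA
  have hinner : ∀ x y : PiLp 2 (fun i => EuclideanSpace ℝ (Fin (N i))), ⟪x, y⟫
      = (fun a : Σ i, Fin (N i) => x a.1 a.2) ⬝ᵥ fun a => y a.1 a.2 := fun x y => by
    simp only [PiLp.inner_apply, dotProduct, Fintype.sum_sigma, RCLike.inner_apply, conj_trivial,
      mul_comm]
  have hHT : (hessMat φ xb).transpose = hessMat φ xb := hessMat_isSymm hφ
  have hAx : ∀ h, (fun a : Σ i, Fin (N i) => A h a.1 a.2)
      = (hessMat φ xb).mulVec fun a => h a.1 a.2 := fun h => by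
    refine dotProduct_eq _ _ fun y => ?_
    have h1 := hA h (WithLp.toLp 2 fun i => WithLp.toLp 2 fun j => y ⟨i, j⟩)
    rw [hinner, fderiv_fderiv_eq_dotProduct, Matrix.dotProduct_mulVec, ← Matrix.mulVec_transpose,
      hHT] at h1
    exact h1
  refine ⟨A, hA, fun x y => ?_, fun h ε => ?_⟩
  · rw [hA, real_inner_comm, hA, hsymm]
  · rw [← real_inner_self_eq_norm_sq, hinner, hinner, hAx, Matrix.add_mulVec, dotProduct_add,
      Matrix.smul_mulVec, dotProduct_smul, smul_eq_mul, ← Matrix.mulVec_mulVec,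
      Matrix.dotProduct_mulVec _ _ ((hessMat φ xb).mulVec _), ← Matrix.mulVec_transpose, hHT,
      add_left_inj]
    exact dotProduct_comm _ _

end ProductCoordinates

section MaximumPrinciple

open RealInnerProductSpace

variable {k : ℕ} {N : Fin k → ℕ}

/-- The function `v i`, translated to the origin and with its linear part removed. -/
def recentered (v : ∀ i, (Fin (N i) → ℝ) → ℝ) (φ : (∀ i, Fin (N i) → ℝ) → ℝ)
    (xb : ∀ i, Fin (N i) → ℝ) (i : Fin k) (u : EuclideanSpace ℝ (Fin (N i))) : ℝ :=
  v i (xb i + u.ofLp) - v i (xb i) - ∑ j, fderiv ℝ φ xb (coordVec ⟨i, j⟩) * u j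

theorem eventually_sum_recentered_le {Oi : ∀ i, Set (Fin (N i) → ℝ)}
    {v : ∀ i, (Fin (N i) → ℝ) → ℝ} {φ : (∀ i, Fin (N i) → ℝ) → ℝ} {xb : ∀ i, Fin (N i) → ℝ}
    (hφ : ContDiffAt ℝ 2 φ xb)
    (hmax : IsLocalMaxOn (fun x => (∑ i, v i (x i)) - φ x) (Set.pi univ Oi) xb)
    {η : ℝ} (hη : 0 < η) :
    ∀ᶠ u : PiLp 2 (fun i => EuclideanSpace ℝ (Fin (N i))) in 𝓝 0,
      (∀ i, xb i + (u i).ofLp ∈ Oi i) → ∑ i, recentered v φ xb i (u i) ≤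
        1 / 2 * fderiv ℝ (fderiv ℝ φ) xb (toCoord N u) (toCoord N u) + η * ‖u‖ ^ 2 := by
  have hT : Tendsto (toCoord N) (𝓝 0) (𝓝 0) := by
    simpa using (toCoord N).continuous.tendsto 0
  have hT' : Tendsto (fun u => xb + toCoord N u) (𝓝 0) (𝓝 xb) := by
    simpa using hT.const_add xb
  have h1 := hT'.eventually (eventually_nhdsWithin_iff.mp hmax)
  have h2 := hT.eventually (hφ.eventually_abs_sub_le
    (η := η / (‖toCoord N‖ ^ 2 + 1)) (by positivity))
  filter_upwards [h1, h2] with u h1 h2 hu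
  have h3 := h1 fun i _ => hu i
  have h4 := (abs_le.mp h2).2
  have h5 : η / (‖toCoord N‖ ^ 2 + 1) * ‖toCoord N u‖ ^ 2 ≤ η * ‖u‖ ^ 2 := by
    have h6 : ‖toCoord N u‖ ^ 2 ≤ (‖toCoord N‖ ^ 2 + 1) * ‖u‖ ^ 2 := by
      have := pow_le_pow_left₀ (norm_nonneg _) ((toCoord N).le_opNorm u) 2
      nlinarith [sq_nonneg ‖u‖]
    calc η / (‖toCoord N‖ ^ 2 + 1) * ‖toCoord N u‖ ^ 2
        ≤ η / (‖toCoord N‖ ^ 2 + 1) * ((‖toCoord N‖ ^ 2 + 1) * ‖u‖ ^ 2) := by gcongr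
      _ = η * ‖u‖ ^ 2 := by field_simp
  have h6 : fderiv ℝ φ xb (toCoord N u)
      = ∑ i, ∑ j, fderiv ℝ φ xb (coordVec ⟨i, j⟩) * u i j := by
    conv_lhs => rw [← sum_smul_coordVec (toCoord N u)]
    simp only [map_sum, map_smul, Fintype.sum_sigma, smul_eq_mul, toCoord_apply, mul_comm]
  simp only [recentered, Finset.sum_sub_distrib, ← h6]
  simp only [Pi.add_apply, toCoord_apply] at h3
  linarith

theorem exists_superjet_blocks {Oi : ∀ i, Set (Fin (N i) → ℝ)}
    (hOlc : ∀ i, LocallyCompactSpace (Oi i)) {v : ∀ i, (Fin (N i) → ℝ) → ℝ}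
    (hv : ∀ i, UpperSemicontinuousOn (v i) (Oi i)) {φ : (∀ i, Fin (N i) → ℝ) → ℝ}
    {xb : ∀ i, Fin (N i) → ℝ} (hφ : ContDiffAt ℝ 2 φ xb) (hxb : ∀ i, xb i ∈ Oi i)
    (hmax : IsLocalMaxOn (fun x => (∑ i, v i (x i)) - φ x) (Set.pi univ Oi) xb)
    {ε : ℝ} (hε : 0 < ε) :
    ∃ C : ℝ, ∀ δ > 0, ∃ (x p : PiLp 2 fun i => EuclideanSpace ℝ (Fin (N i)))
      (S : ∀ i, Matrix (Fin (N i)) (Fin (N i)) ℝ), ‖x‖ ≤ δ ∧ ‖p‖ ≤ δ ∧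
      (∀ i, xb i + (x i).ofLp ∈ Oi i) ∧
      (∀ i, ((fun j => fderiv ℝ φ xb (coordVec ⟨i, j⟩)) + (p i).ofLp, S i) ∈
        superjet (Oi i) (v i) (xb i + (x i).ofLp)) ∧
      (∀ i j l, |S i j l| ≤ C + 3 * δ) ∧
      ∀ z : (Σ i, Fin (N i)) → ℝ, z ⬝ᵥ (blockDiag S).mulVec z ≤
        z ⬝ᵥ (hessMat φ xb + ε • (hessMat φ xb * hessMat φ xb)).mulVec z + δ * z ⬝ᵥ z := by
  obtain ⟨A, hA, hAs, hAq⟩ := exists_hessian_operator hφ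
  refine ⟨3 * (1 / ε + 2 * ‖A‖ + 1 + ε * ‖A‖ ^ 2), fun δ hδ => ?_⟩
  have he : ∀ i, Continuous fun u : EuclideanSpace ℝ (Fin (N i)) => xb i + u.ofLp := fun i => by
    fun_prop
  have hO' : ∀ i, ∀ U ∈ 𝓝 (0 : EuclideanSpace ℝ (Fin (N i))),
      ∃ K ⊆ U ∩ {u | xb i + u.ofLp ∈ Oi i}, IsCompact K ∧ K ∈ 𝓝[{u | xb i + u.ofLp ∈ Oi i}] 0 := by
    intro i U hU
    have : LocallyCompactSpace {u : EuclideanSpace ℝ (Fin (N i)) | xb i + u.ofLp ∈ Oi i} := by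
      let e := (EuclideanSpace.equiv (Fin (N i)) ℝ).toHomeomorph.trans (Homeomorph.addLeft (xb i))
      exact (e.subtype (p := fun u => xb i + u.ofLp ∈ Oi i) (q := (· ∈ Oi i))
        fun _ => Iff.rfl).isClosedEmbedding.locallyCompactSpace
    exact exists_isCompact_mem_nhdsWithin (by simpa using hxb i) hU
  have hw : ∀ i, UpperSemicontinuousOn (recentered v φ xb i) {u | xb i + u.ofLp ∈ Oi i} := by
    intro i
    have h1 : UpperSemicontinuousOn (fun u : EuclideanSpace ℝ (Fin (N i)) => v i (xb i + u.ofLp))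
        {u | xb i + u.ofLp ∈ Oi i} := (hv i).comp (he i).continuousOn fun _ hu => hu
    have h2 : UpperSemicontinuousOn (fun u : EuclideanSpace ℝ (Fin (N i)) =>
        -v i (xb i) - ∑ j, fderiv ℝ φ xb (coordVec ⟨i, j⟩) * u j) {u | xb i + u.ofLp ∈ Oi i} :=
      ContinuousOn.upperSemicontinuousOn (by fun_prop)
    have h3 : recentered v φ xb i = fun u => v i (xb i + u.ofLp)
        + (-v i (xb i) - ∑ j, fderiv ℝ φ xb (coordVec ⟨i, j⟩) * u j) := by
      ext u
      simp only [recentered]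
      ring
    exact h3 ▸ h1.add h2
  obtain ⟨x, p, Y, hxO, hx, hp, hjet, hY⟩ := exists_hasSuperjetOn_of_eventually_sum_le hO' hw
    (fun i => by simpa using hxb i) (fun i => by simp [recentered]) hAs
    (fun η hη => by simpa only [hA, mem_ofPred_eq] using
      eventually_sum_recentered_le hφ hmax hη) hε hδ
  refine ⟨x, p, fun i => symMatrix (Y i), hx, hp, hxO, fun i => (hjet i).mem_superjet,
    fun i => ?_, fun z => ?_⟩
  · have h1 : ∀ h, |⟪Y i h, h⟫| ≤ (1 / ε + 2 * ‖A‖ + 1 + ε * ‖A‖ ^ 2 + δ) * ‖h‖ ^ 2 := fun h => by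
      let g : PiLp 2 (fun i => EuclideanSpace ℝ (Fin (N i))) := PiLp.single 2 i h
      have hg : ‖g‖ = ‖h‖ := PiLp.norm_single ..
      have h2 := hY g
      have h3 : ∑ i', ⟪Y i' (g i'), g i'⟫ = ⟪Y i h, h⟫ := by
        rw [Finset.sum_eq_single i]
        · simp [g]
        · intro i' _ hi
          simp [g, hi]
        · simp
      rw [h3, hg] at h2
      have h4 : ‖A g‖ ≤ ‖A‖ * ‖h‖ := hg ▸ A.le_opNorm g
      have h5 : ⟪A g, g⟫ ≤ ‖A‖ * ‖h‖ ^ 2 := by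
        refine (real_inner_le_norm _ _).trans ?_
        rw [pow_two, ← mul_assoc, hg]
        gcongr
      have h6 : ε * ‖A g‖ ^ 2 ≤ ε * (‖A‖ * ‖h‖) ^ 2 := by gcongr
      have h7 : 0 ≤ ‖A‖ * ‖h‖ ^ 2 := by positivity
      have h8 : 0 ≤ ε * (‖A‖ * ‖h‖) ^ 2 := by positivity
      have h9 : 0 ≤ 1 / ε * ‖h‖ ^ 2 := by positivity
      have h10 : 0 ≤ δ * ‖h‖ ^ 2 := by positivity
      rw [abs_le]
      constructor <;> linarith [h2.1, h2.2, sq_nonneg ‖h‖]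
    intro j l
    have := abs_symMatrix_le (Y i) h1 j l
    linarith
  · set h : PiLp 2 (fun i => EuclideanSpace ℝ (Fin (N i))) :=
      WithLp.toLp 2 fun i => WithLp.toLp 2 fun j => z ⟨i, j⟩
    have h1 := (hY h).2
    rw [← hAq h ε] at h1
    have h2 : ‖h‖ ^ 2 = z ⬝ᵥ z := by
      rw [PiLp.norm_sq_eq_of_L2]
      simp only [EuclideanSpace.real_norm_sq_eq, h, dotProduct, Fintype.sum_sigma]
      simp only [pow_two]
    have h3 : ∑ i, ⟪Y i (h i), h i⟫ = z ⬝ᵥ (blockDiag fun i => symMatrix (Y i)).mulVec z := by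
      rw [dotProduct_blockDiag_mulVec]
      exact Finset.sum_congr rfl fun i _ => (sum_symMatrix (Y i) (h i)).symm
    rwa [h2, h3] at h1

end MaximumPrinciple

theorem maximum_principle_semicontinuous (k : ℕ) (N : Fin k → ℕ)
    (Oi : ∀ i, Set (Fin (N i) → ℝ))
    (hOlc : ∀ i, LocallyCompactSpace ↥(Oi i))
    (v : ∀ i, (Fin (N i) → ℝ) → ℝ)
    (hv : ∀ i, UpperSemicontinuousOn (v i) (Oi i))
    (φ : (∀ i, Fin (N i) → ℝ) → ℝ)
    (hφ : ∀ x ∈ Set.pi univ Oi, ContDiffAt ℝ 2 φ x)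
    (xb : ∀ i, Fin (N i) → ℝ) (hxb : xb ∈ Set.pi univ Oi)
    (hmax : IsLocalMaxOn (fun x => (∑ i, v i (x i)) - φ x) (Set.pi univ Oi) xb) :
    ∀ ε > (0 : ℝ), ∃ X : ∀ i, Matrix (Fin (N i)) (Fin (N i)) ℝ,
      (∀ i, (X i).IsSymm) ∧
      (∀ i, ((fun j => fderiv ℝ φ xb (coordVec ⟨i, j⟩)), X i) ∈
        superjetCl (Oi i) (v i) (xb i)) ∧
      (hessMat φ xb + ε • (hessMat φ xb * hessMat φ xb) - blockDiag X).PosSemidef := by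
  intro ε hε
  have hx0 : ∀ i, xb i ∈ Oi i := fun i => hxb i (mem_univ i)
  have hφ' := hφ xb hxb
  obtain ⟨C, hC⟩ := exists_superjet_blocks hOlc hv hφ' hx0 hmax hε
  have hδ : ∀ n : ℕ, 0 < 1 / ((n : ℝ) + 1) := fun n => by positivity
  have hδ1 : ∀ n : ℕ, 1 / ((n : ℝ) + 1) ≤ 1 := fun n =>
    (div_le_one (by positivity)).mpr (by linarith [n.cast_nonneg (α := ℝ)])
  choose x p S hx hp hxO hS hSC hSq using fun n : ℕ => hC _ (hδ n)
  let K : Set (∀ i, Fin (N i) → Fin (N i) → ℝ) :=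
    univ.pi fun i => univ.pi fun _ => univ.pi fun _ => Icc (-(C + 3)) (C + 3)
  have hK : IsCompact K := isCompact_univ_pi fun i => isCompact_univ_pi fun _ =>
    isCompact_univ_pi fun _ => isCompact_Icc
  have hSK : ∀ n, (S n : ∀ i, Fin (N i) → Fin (N i) → ℝ) ∈ K := fun n i _ j _ l _ =>
    abs_le.mp ((hSC n i j l).trans (by linarith [hδ1 n]))
  obtain ⟨X, -, ψ, hψ, hlim⟩ := hK.tendsto_subseq hSK
  have hlimi : ∀ i, Tendsto (fun n => S (ψ n) i) atTop (𝓝 (Matrix.of (X i))) := fun i =>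
    (tendsto_pi_nhds.mp hlim) i
  have hδ0 : Tendsto (fun n => 1 / ((ψ n : ℝ) + 1)) atTop (𝓝 0) :=
    (tendsto_one_div_add_atTop_nhds_zero_nat (𝕜 := ℝ)).comp hψ.tendsto_atTop
  have hzero : ∀ y : ℕ → PiLp 2 (fun i => EuclideanSpace ℝ (Fin (N i))),
      (∀ n, ‖y n‖ ≤ 1 / ((n : ℝ) + 1)) → ∀ i, Tendsto (fun n => (y (ψ n) i).ofLp) atTop (𝓝 0) := by
    intro y hy i
    have h1 : Tendsto (fun n => y (ψ n)) atTop (𝓝 0) :=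
      squeeze_zero_norm (fun n => hy (ψ n)) hδ0
    have h2 : Continuous fun u : PiLp 2 (fun i => EuclideanSpace ℝ (Fin (N i))) =>
        (u i).ofLp := by fun_prop
    exact (h2.tendsto 0).comp h1
  have hXsymm : ∀ i, (Matrix.of (X i)).IsSymm := fun i =>
    tendsto_nhds_unique ((continuous_id.matrix_transpose.tendsto _).comp (hlimi i))
      ((hlimi i).congr fun n => (hS (ψ n) i).1.eq.symm)
  refine ⟨fun i => Matrix.of (X i), hXsymm, fun i => ?_, ?_⟩
  · refine ⟨fun n => xb i + (x (ψ n) i).ofLp, fun n => (_, S (ψ n) i),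
      fun n => ⟨hxO (ψ n) i, hS (ψ n) i⟩, ?_, ?_⟩
    · simpa using (hzero x hx i).const_add (xb i)
    · refine Tendsto.prodMk_nhds ?_ (hlimi i)
      simpa using (hzero p hp i).const_add fun j => fderiv ℝ φ xb (coordVec ⟨i, j⟩)
  · have hH := hessMat_isSymm hφ'
    refine Matrix.PosSemidef.of_dotProduct_mulVec_nonneg ?_ fun z => ?_
    · rw [Matrix.IsHermitian, Matrix.conjTranspose_eq_transpose_of_trivial, Matrix.transpose_sub,
        Matrix.transpose_add, Matrix.transpose_smul, Matrix.transpose_mul, hH.eq,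
        (blockDiag_isSymm hXsymm).eq]
    · rw [star_trivial, Matrix.sub_mulVec, dotProduct_sub, sub_nonneg]
      have h1 : Tendsto (fun n => z ⬝ᵥ (blockDiag (S (ψ n))).mulVec z) atTop
          (𝓝 (z ⬝ᵥ (blockDiag fun i => Matrix.of (X i)).mulVec z)) := by
        simp only [dotProduct_blockDiag_mulVec]
        refine tendsto_finsetSum _ fun i _ => tendsto_finsetSum _ fun j _ =>
          tendsto_finsetSum _ fun l _ => ?_
        have h2 : Tendsto (fun n => S (ψ n) i j l) atTop (𝓝 (X i j l)) :=
          tendsto_pi_nhds.mp (tendsto_pi_nhds.mp (hlimi i) j) l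
        exact (h2.mul_const _).mul_const _
      have h2 := (hδ0.mul_const (z ⬝ᵥ z)).const_add
        (z ⬝ᵥ (hessMat φ xb + ε • (hessMat φ xb * hessMat φ xb)).mulVec z)
      rw [zero_mul, add_zero] at h2
      exact le_of_tendsto_of_tendsto' h1 h2 fun n => hSq (ψ n) z
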